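/- For every φ ∈ C_c(ℝ), the convolution operator M_φ, defined by (M_φ f)(x) = ∫_ℝ f(x−y)φ(y) dy, is a bounded linear operator on H and is a multiplier, i.e. M_φ S_x = S_x M_φ for all x ∈ ℝ. -/

import Mathlib

open MeasureTheory Complex Real Filter Topology

noncomputable section

/-- A Hilbert space `H` of (locally integrable) functions on `ℝ` satisfying the
hypotheses (H1)-(H4) of the paper. -/
structure MultiplierSetup (H : Type) [NormedAddCommGroup H]
    [InnerProductSpace ℂ H] [CompleteSpace H] where
  /-- the inclusion of `H` into (a.e. classes of) functions on `ℝ` -/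
  ι : H →ₗ[ℂ] (ℝ →ₘ[volume] ℂ)
  ι_inj : Function.Injective ι
  /-- `H ⊆ L¹_loc(ℝ)` -/
  locInt : ∀ f : H, LocallyIntegrable (ι f) volume
  /-- `C_c(ℝ) ⊆ H` -/
  ofCc : CompactlySupportedContinuousMap ℝ ℂ → H
  ofCc_spec : ∀ φ : CompactlySupportedContinuousMap ℝ ℂ,
    (ι (ofCc φ) : ℝ → ℂ) =ᵐ[volume] φ
  /-- `C_c(ℝ)` is dense in `H` -/
  ofCc_dense : DenseRange ofCc
  /-- (H1): both inclusions are continuous -/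
  incl_cont : ∀ K : Set ℝ, IsCompact K → ∃ c > 0,
    (∀ φ : CompactlySupportedContinuousMap ℝ ℂ, tsupport (φ : ℝ → ℂ) ⊆ K →
      ‖ofCc φ‖ ≤ c * ⨆ x, ‖φ x‖) ∧
    (∀ f : H, (∫ x in K, ‖(ι f : ℝ → ℂ) x‖) ≤ c * ‖f‖)
  /-- (H2): the translation group acting boundedly on `H` -/
  S : ℝ → H →L[ℂ] H
  S_spec : ∀ (x : ℝ) (f : H), ((ι (S x f)) : ℝ → ℂ) =ᵐ[volume]
    fun y => (ι f : ℝ → ℂ) (y - x)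
  S_add : ∀ x y : ℝ, (S x).comp (S y) = S (x + y)
  S_zero : S 0 = 1
  S_loc_bdd : ∀ K : Set ℝ, IsCompact K → ∃ C : ℝ, ∀ x ∈ K, ‖S x‖ ≤ C
  /-- (H3): the modulations act on `H`, uniformly boundedly -/
  T : ℝ → H →L[ℂ] H
  T_spec : ∀ (α : ℝ) (f : H), ((ι (T α f)) : ℝ → ℂ) =ᵐ[volume]
    fun x => Complex.exp (Complex.I * α * x) * (ι f : ℝ → ℂ) x
  T_bdd : ∃ C : ℝ, ∀ α : ℝ, ‖T α‖ ≤ C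
  /-- (H4): exponential bound on the norms of the translations -/
  S_exp : ∃ C > 0, ∃ a ≥ 0, ∀ x : ℝ, ‖S x‖ ≤ C * Real.exp (a * |x|)

namespace MultiplierSetup

variable {H : Type} [NormedAddCommGroup H] [InnerProductSpace ℂ H] [CompleteSpace H]
  (P : MultiplierSetup H)

theorem eq_of_coeFn_ae_eq {f g : H} (h : (P.ι f : ℝ → ℂ) =ᵐ[volume] P.ι g) : f = g :=
  P.ι_inj (AEEqFun.ext h)

theorem coeFn_sub (f g : H) :
    (P.ι (f - g) : ℝ → ℂ) =ᵐ[volume] fun x => (P.ι f : ℝ → ℂ) x - (P.ι g : ℝ → ℂ) x := by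
  rw [map_sub]
  exact AEEqFun.coeFn_sub _ _

/-- The right translate of a compactly supported continuous function. -/
def translate (x : ℝ) (g : CompactlySupportedContinuousMap ℝ ℂ) :
    CompactlySupportedContinuousMap ℝ ℂ where
  toFun y := g (y - x)
  continuous_toFun := by fun_prop
  hasCompactSupport' :=
    g.hasCompactSupport.comp_homeomorph (Homeomorph.subRight x)

theorem S_ofCc_sub (x : ℝ) (g : CompactlySupportedContinuousMap ℝ ℂ) :
    P.S x (P.ofCc g) - P.ofCc g = P.ofCc (translate x g - g) := by
  apply P.eq_of_coeFn_ae_eq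
  have hq : (fun y => (P.ι (P.ofCc g) : ℝ → ℂ) (y - x)) =ᵐ[volume] fun y => g (y - x) :=
    (measurePreserving_sub_right volume x).quasiMeasurePreserving.ae_eq (P.ofCc_spec g)
  filter_upwards [P.coeFn_sub (P.S x (P.ofCc g)) (P.ofCc g), P.S_spec x (P.ofCc g), hq,
    P.ofCc_spec g, P.ofCc_spec (translate x g - g)] with y h₁ h₂ h₃ h₄ h₅
  rw [h₁, h₂, h₃, h₄, h₅]
  rfl

open scoped Pointwise in
theorem tendsto_S_ofCc (g : CompactlySupportedContinuousMap ℝ ℂ) :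
    Tendsto (fun x => P.S x (P.ofCc g)) (𝓝 0) (𝓝 (P.ofCc g)) := by
  have hg : IsCompact (tsupport (g : ℝ → ℂ)) := g.hasCompactSupport
  have hK : IsCompact (tsupport (g : ℝ → ℂ) + Metric.closedBall (0 : ℝ) 1) :=
    hg.add (isCompact_closedBall _ _)
  obtain ⟨c, hc, hbound, -⟩ := P.incl_cont _ hK
  have huc : UniformContinuous (g : ℝ → ℂ) :=
    g.hasCompactSupport.uniformContinuous_of_continuous g.continuous
  rw [Metric.tendsto_nhds]
  intro ε hε
  obtain ⟨δ, hδ, hgδ⟩ := Metric.uniformContinuous_iff.1 huc (ε / (2 * c)) (by positivity)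
  filter_upwards [Metric.ball_mem_nhds (0 : ℝ) (lt_min hδ one_pos)] with x hx
  rw [mem_ball_zero_iff, lt_min_iff] at hx
  rw [dist_eq_norm, S_ofCc_sub]
  have hsupp : tsupport ((translate x g - g : CompactlySupportedContinuousMap ℝ ℂ) : ℝ → ℂ) ⊆
      tsupport (g : ℝ → ℂ) + Metric.closedBall (0 : ℝ) 1 := by
    refine closure_minimal (fun y hy => ?_) hK.isClosed
    by_cases hy' : g y = 0
    · have hyx : g (y - x) ≠ 0 := fun h => hy (by
        change g (y - x) - g y = 0
        rw [h, hy', sub_zero])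
      exact ⟨y - x, subset_tsupport _ hyx, x, by simpa using hx.2.le, sub_add_cancel _ _⟩
    · exact ⟨y, subset_tsupport _ hy', 0, by simp, add_zero _⟩
  have hsup : ⨆ y, ‖(translate x g - g : CompactlySupportedContinuousMap ℝ ℂ) y‖ ≤
      ε / (2 * c) := by
    refine ciSup_le fun y => ?_
    have : dist (g (y - x)) (g y) < ε / (2 * c) := hgδ (by
      rw [dist_eq_norm]; simpa using hx.1)
    rw [dist_eq_norm] at this
    exact this.le
  calc _ ≤ c * ⨆ y, ‖(translate x g - g : CompactlySupportedContinuousMap ℝ ℂ) y‖ :=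
        hbound _ hsupp
    _ ≤ c * (ε / (2 * c)) := by gcongr
    _ = ε / 2 := by field_simp
    _ < ε := half_lt_self hε

theorem tendsto_S_zero (f : H) : Tendsto (fun x => P.S x f) (𝓝 0) (𝓝 f) := by
  obtain ⟨C, hC⟩ := P.S_loc_bdd _ (isCompact_closedBall (0 : ℝ) 1)
  have hC0 : 0 ≤ C := (norm_nonneg _).trans (hC 0 (by simp))
  rw [Metric.tendsto_nhds]
  intro ε hε
  obtain ⟨g, hg⟩ := P.ofCc_dense.exists_dist_lt f (ε := ε / (2 * (C + 1))) (by positivity)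
  filter_upwards [Metric.closedBall_mem_nhds (0 : ℝ) one_pos,
    Metric.tendsto_nhds.1 (P.tendsto_S_ofCc g) (ε / 2) (half_pos hε)] with x hx hx'
  have h₁ : dist (P.S x f) (P.S x (P.ofCc g)) ≤ C * dist f (P.ofCc g) := by
    rw [dist_eq_norm, dist_eq_norm, ← map_sub]
    exact (P.S x).le_of_opNorm_le (hC x hx) _
  have h₂ : (C + 1) * dist f (P.ofCc g) < ε / 2 := by
    calc _ < (C + 1) * (ε / (2 * (C + 1))) := by gcongr
      _ = ε / 2 := by field_simp
  have h₃ := dist_triangle4 (P.S x f) (P.S x (P.ofCc g)) (P.ofCc g) f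
  rw [dist_comm (P.ofCc g) f] at h₃
  linarith

theorem S_comm_apply (x y : ℝ) (f : H) : P.S x (P.S y f) = P.S y (P.S x f) := by
  rw [← ContinuousLinearMap.comp_apply, ← ContinuousLinearMap.comp_apply, P.S_add, P.S_add,
    add_comm]

/-- The translation group of `H` is strongly continuous. -/
theorem continuous_S_apply (f : H) : Continuous fun x => P.S x f := by
  refine continuous_iff_continuousAt.2 fun x => ?_
  have hsub : Tendsto (fun y => y - x) (𝓝 x) (𝓝 0) := by
    simpa using (continuous_sub_right x).tendsto x
  have h := ((P.S x).continuous.tendsto f).comp ((P.tendsto_S_zero f).comp hsub)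
  refine h.congr fun y => ?_
  change (P.S x).comp (P.S (y - x)) f = P.S y f
  rw [P.S_add, add_sub_cancel]

variable (φ : CompactlySupportedContinuousMap ℝ ℂ)

theorem integrable_smul_S (f : H) : Integrable fun y => φ y • P.S y f :=
  (φ.continuous.smul (P.continuous_S_apply f)).integrable_of_hasCompactSupport
    φ.hasCompactSupport.smul_right

/-- The convolution operator `f ↦ ∫ φ(y) S_y f dy`, as a Bochner integral in `H`. -/
def convOp : H →L[ℂ] H :=
  LinearMap.mkContinuousOfExistsBound
    { toFun := fun f => ∫ y, φ y • P.S y f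
      map_add' := fun f g => by
        simp only [map_add, smul_add]
        exact integral_add (P.integrable_smul_S φ f) (P.integrable_smul_S φ g)
      map_smul' := fun a f => by
        simp only [map_smul, RingHom.id_apply, smul_comm _ a]
        exact integral_smul a _ }
    (by
      obtain ⟨C, hC⟩ := P.S_loc_bdd _ φ.hasCompactSupport
      have hφ : Integrable fun y => ‖φ y‖ :=
        (φ.continuous.integrable_of_hasCompactSupport φ.hasCompactSupport).norm
      refine ⟨(∫ y, ‖φ y‖) * C, fun f => ?_⟩
      rw [mul_assoc, ← integral_mul_const]
      refine norm_integral_le_of_norm_le (hφ.mul_const _) (ae_of_all _ fun y => ?_)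
      rw [norm_smul]
      by_cases hy : y ∈ tsupport (φ : ℝ → ℂ)
      · gcongr
        exact (P.S y).le_of_opNorm_le (hC y hy) f
      · simp [image_eq_zero_of_notMem_tsupport hy])

theorem convOp_apply (f : H) : P.convOp φ f = ∫ y, φ y • P.S y f := rfl

theorem convOp_comp_S (x : ℝ) :
    (P.convOp φ).comp (P.S x) = (P.S x).comp (P.convOp φ) := by
  ext f
  simp only [ContinuousLinearMap.comp_apply, convOp_apply]
  rw [← ContinuousLinearMap.integral_comp_comm _ (P.integrable_smul_S φ f)]
  simp only [map_smul, P.S_comm_apply x]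

theorem integrableOn (f : H) {K : Set ℝ} (hK : IsCompact K) :
    IntegrableOn (P.ι f : ℝ → ℂ) K :=
  (P.locInt f).integrableOn_isCompact hK

/-- Integration over a compact set, as a continuous functional on `H`. -/
def setIntegralCLM {K : Set ℝ} (hK : IsCompact K) : H →L[ℂ] ℂ :=
  LinearMap.mkContinuousOfExistsBound
    { toFun := fun f => ∫ x in K, (P.ι f : ℝ → ℂ) x
      map_add' := fun f g => by
        rw [map_add, ← integral_add (P.integrableOn f hK) (P.integrableOn g hK)]
        exact integral_congr_ae (ae_restrict_of_ae (AEEqFun.coeFn_add _ _))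
      map_smul' := fun a f => by
        rw [map_smul, RingHom.id_apply, ← integral_smul]
        exact integral_congr_ae (ae_restrict_of_ae (AEEqFun.coeFn_smul _ _)) }
    (by
      obtain ⟨c, -, -, hc⟩ := P.incl_cont K hK
      exact ⟨c, fun f => (norm_integral_le_integral_norm _).trans (hc f)⟩)

theorem setIntegralCLM_apply {K : Set ℝ} (hK : IsCompact K) (f : H) :
    P.setIntegralCLM hK f = ∫ x in K, (P.ι f : ℝ → ℂ) x := rfl

end MultiplierSetup

open scoped Pointwise in
/-- Fubini for the convolution of a locally integrable function with a compactly supported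
continuous one, over a compact set. -/
theorem setIntegral_integral_sub_mul_swap {f : ℝ → ℂ} (hf : LocallyIntegrable f)
    (φ : CompactlySupportedContinuousMap ℝ ℂ) {K : Set ℝ} (hK : IsCompact K) :
    ∫ x in K, ∫ y, f (x - y) * φ y = ∫ y, ∫ x in K, f (x - y) * φ y := by
  have hK' : IsCompact (K - tsupport (φ : ℝ → ℂ)) := by
    rw [sub_eq_add_neg]
    exact hK.add (IsCompact.neg φ.hasCompactSupport)
  set h := (K - tsupport (φ : ℝ → ℂ)).indicator f
  have hh : Integrable h :=
    (integrable_indicator_iff hK'.measurableSet).2 (hf.integrableOn_isCompact hK')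
  have hφ : Integrable (φ : ℝ → ℂ) :=
    φ.continuous.integrable_of_hasCompactSupport φ.hasCompactSupport
  have heq : ∀ x ∈ K, ∀ y, f (x - y) * φ y = h (x - y) * φ y := fun x hx y => by
    by_cases hy : y ∈ tsupport (φ : ℝ → ℂ)
    · rw [show h (x - y) = f (x - y) from Set.indicator_of_mem (Set.sub_mem_sub hx hy) f]
    · simp [image_eq_zero_of_notMem_tsupport hy]
  have hint : Integrable (fun p : ℝ × ℝ => h (p.1 - p.2) * φ p.2)
      ((volume.restrict K).prod volume) := by
    have := hφ.convolution_integrand (ContinuousLinearMap.mul ℂ ℂ) hh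
    have h' : Integrable (fun p : ℝ × ℝ => h (p.1 - p.2) * φ p.2) (volume.prod volume) := by
      simpa [mul_comm] using this
    exact h'.mono_measure (Measure.prod_mono Measure.restrict_le_self le_rfl)
  calc ∫ x in K, ∫ y, f (x - y) * φ y = ∫ x in K, ∫ y, h (x - y) * φ y :=
        setIntegral_congr_fun hK.measurableSet fun x hx => by simp only [heq x hx]
    _ = ∫ y, ∫ x in K, h (x - y) * φ y := integral_integral_swap hint
    _ = ∫ y, ∫ x in K, f (x - y) * φ y := by
        congr 1 with y
        exact (setIntegral_congr_fun hK.measurableSet fun x hx => heq x hx y).symm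

theorem MultiplierSetup.coeFn_convOp {H : Type} [NormedAddCommGroup H]
    [InnerProductSpace ℂ H] [CompleteSpace H] (P : MultiplierSetup H)
    (φ : CompactlySupportedContinuousMap ℝ ℂ) (f : H) :
    (P.ι (P.convOp φ f) : ℝ → ℂ) =ᵐ[volume]
      fun x => ∫ y : ℝ, (P.ι f : ℝ → ℂ) (x - y) * φ y := by
  have hcont : Continuous fun x => ∫ y : ℝ, (P.ι f : ℝ → ℂ) (x - y) * φ y := by
    have := φ.hasCompactSupport.continuous_convolution_left (ContinuousLinearMap.mul ℂ ℂ)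
      φ.continuous (P.locInt f)
    refine this.congr fun x => ?_
    simp only [convolution_def, ContinuousLinearMap.mul_apply', mul_comm]
  refine (sub_ae_eq_zero _ _).1 ?_
  refine ae_eq_zero_of_forall_setIntegral_isCompact_eq_zero'
    ((P.locInt _).sub hcont.locallyIntegrable) fun K hK => ?_
  have hleft : ∫ x in K, (P.ι (P.convOp φ f) : ℝ → ℂ) x =
      ∫ y, ∫ x in K, (P.ι f : ℝ → ℂ) (x - y) * φ y := by
    rw [← P.setIntegralCLM_apply hK, P.convOp_apply,
      ← ContinuousLinearMap.integral_comp_comm _ (P.integrable_smul_S φ f)]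
    congr 1 with y
    rw [map_smul, P.setIntegralCLM_apply, smul_eq_mul, integral_mul_const, mul_comm,
      integral_congr_ae (ae_restrict_of_ae (P.S_spec y f))]
  simp only [Pi.sub_apply]
  rw [integral_sub (P.integrableOn _ hK) (hcont.locallyIntegrable.integrableOn_isCompact hK),
    hleft, setIntegral_integral_sub_mul_swap (P.locInt f) φ hK, sub_self]

/-- For every `φ ∈ C_c(ℝ)`, the convolution `f ↦ ∫ f(· - y) φ(y) dy` is (realized by) a
bounded linear operator `N` on `H`, and `N` is a multiplier: `N S_x = S_x N` for all
`x ∈ ℝ`. -/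
theorem convolution_is_multiplier {H : Type} [NormedAddCommGroup H]
    [InnerProductSpace ℂ H] [CompleteSpace H] (P : MultiplierSetup H)
    (φ : CompactlySupportedContinuousMap ℝ ℂ) :
    ∃ N : H →L[ℂ] H,
      (∀ f : H, (P.ι (N f) : ℝ → ℂ) =ᵐ[volume]
        fun x => ∫ y : ℝ, (P.ι f : ℝ → ℂ) (x - y) * φ y) ∧
      ∀ x : ℝ, N.comp (P.S x) = (P.S x).comp N :=
  ⟨P.convOp φ, P.coeFn_convOp φ, P.convOp_comp_S φ⟩
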